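/- arXiv:2012.15469 — 4 statements merged into one kernel-verified Lean document; each statement's English description precedes it below -/
import Mathlib

section
/- Bounded per-step drift of the adaptive iterates (Lemma 4 of the supplement). Let p ≥ 1 be an integer, ε > 0, and 0 ≤ β₁ < √β₂ < 1, and set β₃ = β₁²/β₂. Let (∇^k)_{k ≥ 0} be any sequence of vectors in ℝ^p, and let (α_k) be positive stepsizes. Define h^{k+1} = β₁ h^k + (1−β₁) ∇^k with h⁰ = 0; entrywise v_i^{k+1} = β₂ v̂_i^k + (1−β₂)(∇_i^k)² and v̂_i^{k+1} = max{v_i^{k+1}, v̂_i^k}, with v̂_i^0 ≥ 0 for every i; and θ_i^{k+1} = θ_i^k − α_k (ε + v̂_i^{k+1})^{−1/2} h_i^{k+1} from an arbitrary θ⁰ ∈ ℝ^p. Then for every k ≥ 0: ‖θ^{k+1} − θ^k‖² ≤ α_k² · p · (1−β₂)^{−1} (1−β₃)^{−1}. -/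
noncomputable section

/-- Weighted Young inequality, with weight `b ^ 2 / c` on the first summand. -/
theorem add_sq_le_of_sq_lt {b c : ℝ} (hbc : b ^ 2 < c) (x y : ℝ) :
    (b * x + y) ^ 2 ≤ c * x ^ 2 + (1 - b ^ 2 / c)⁻¹ * y ^ 2 := by
  have hc : 0 < c := (sq_nonneg b).trans_lt hbc
  have hd : 0 < c - b ^ 2 := sub_pos.2 hbc
  have key : c * x ^ 2 + (1 - b ^ 2 / c)⁻¹ * y ^ 2 - (b * x + y) ^ 2 =
      ((c - b ^ 2) * x - b * y) ^ 2 / (c - b ^ 2) := by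
    rw [show 1 - b ^ 2 / c = (c - b ^ 2) / c by field_simp, inv_div]
    field_simp
    ring
  have : 0 ≤ ((c - b ^ 2) * x - b * y) ^ 2 / (c - b ^ 2) := by positivity
  linarith

/-- One step of the momentum and second-moment recursions preserves the bound of the squared
momentum by a multiple of the second moment. -/
theorem momentum_sq_le_step {b c : ℝ} (hb : 0 ≤ b) (hb1 : b < 1) (hbc : b ^ 2 < c) (hc1 : c < 1)
    {x g w : ℝ} (hx : x ^ 2 ≤ (1 - c)⁻¹ * (1 - b ^ 2 / c)⁻¹ * w) :
    (b * x + (1 - b) * g) ^ 2 ≤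
      (1 - c)⁻¹ * (1 - b ^ 2 / c)⁻¹ * (c * w + (1 - c) * g ^ 2) := by
  have hc : 0 < c := (sq_nonneg b).trans_lt hbc
  have hD : 0 < (1 - b ^ 2 / c)⁻¹ := inv_pos.2 (sub_pos.2 ((div_lt_one hc).2 hbc))
  have hg : ((1 - b) * g) ^ 2 ≤ g ^ 2 := by
    rw [mul_pow]
    exact mul_le_of_le_one_left (sq_nonneg g) (pow_le_one₀ (by linarith) (by linarith))
  have hne : 1 - c ≠ 0 := by linarith
  calc (b * x + (1 - b) * g) ^ 2
      ≤ c * x ^ 2 + (1 - b ^ 2 / c)⁻¹ * ((1 - b) * g) ^ 2 := add_sq_le_of_sq_lt hbc _ _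
    _ ≤ c * ((1 - c)⁻¹ * (1 - b ^ 2 / c)⁻¹ * w) + (1 - b ^ 2 / c)⁻¹ * g ^ 2 := by gcongr
    _ = (1 - c)⁻¹ * (1 - b ^ 2 / c)⁻¹ * (c * w)
          + (1 - c)⁻¹ * (1 - c) * (1 - b ^ 2 / c)⁻¹ * g ^ 2 := by
        rw [inv_mul_cancel₀ hne]; ring
    _ = _ := by ring

/-- Bounded per-step drift of the adaptive iterates (Lemma 4 of the supplement):
for the Adam/AMSGrad-type update of CADA,
`‖θ^{k+1} − θ^k‖² ≤ α_k² p (1−β₂)⁻¹ (1−β₃)⁻¹` with `β₃ = β₁²/β₂`. -/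
theorem adam_iterate_drift_bound
    (p : ℕ) (hp : 1 ≤ p) (ε β₁ β₂ : ℝ)
    (hε : 0 < ε) (hβ₁ : 0 ≤ β₁) (hβ₁₂ : β₁ < Real.sqrt β₂) (hβ₂ : Real.sqrt β₂ < 1)
    (β₃ : ℝ) (hβ₃ : β₃ = β₁ ^ 2 / β₂)
    (G : ℕ → EuclideanSpace ℝ (Fin p)) (α : ℕ → ℝ) (hα : ∀ k, 0 < α k)
    (h v : ℕ → EuclideanSpace ℝ (Fin p)) (vhat : ℕ → Fin p → ℝ)
    (θ : ℕ → EuclideanSpace ℝ (Fin p))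
    (hh0 : h 0 = 0)
    (hh : ∀ k, h (k + 1) = β₁ • h k + (1 - β₁) • G k)
    (hv : ∀ k i, v (k + 1) i = β₂ * vhat k i + (1 - β₂) * (G k i) ^ 2)
    (hvhat : ∀ k i, vhat (k + 1) i = max (v (k + 1) i) (vhat k i))
    (hvhat0 : ∀ i, 0 ≤ vhat 0 i)
    (hθ : ∀ k i, θ (k + 1) i = θ k i - α k * (Real.sqrt (ε + vhat (k + 1) i))⁻¹ * h (k + 1) i) :
    ∀ k : ℕ, ‖θ (k + 1) - θ k‖ ^ 2 ≤ α k ^ 2 * p * (1 - β₂)⁻¹ * (1 - β₃)⁻¹ := by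
  have hβ₂0 : 0 < β₂ := Real.sqrt_pos.1 (hβ₁.trans_lt hβ₁₂)
  have hβ₂1 : β₂ < 1 := by simpa using (Real.sqrt_lt' one_pos).1 hβ₂
  have hsq : β₁ ^ 2 < β₂ := (Real.lt_sqrt hβ₁).1 hβ₁₂
  have hβ₁1 : β₁ < 1 := hβ₁₂.trans hβ₂
  have hC : 0 < (1 - β₂)⁻¹ * (1 - β₁ ^ 2 / β₂)⁻¹ :=
    mul_pos (inv_pos.2 (sub_pos.2 hβ₂1))
      (inv_pos.2 (sub_pos.2 ((div_lt_one hβ₂0).2 hsq)))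
  subst hβ₃
  have hvhat_nonneg (k : ℕ) (i : Fin p) : 0 ≤ vhat k i := by
    induction k with
    | zero => exact hvhat0 i
    | succ k ih => rw [hvhat]; exact le_max_of_le_right ih
  have hmom (k : ℕ) (i : Fin p) :
      (h k i) ^ 2 ≤ (1 - β₂)⁻¹ * (1 - β₁ ^ 2 / β₂)⁻¹ * vhat k i := by
    induction k with
    | zero =>
      rw [hh0]
      simpa using mul_nonneg hC.le (hvhat0 i)
    | succ k ih =>
      have hstep := momentum_sq_le_step hβ₁ hβ₁1 hsq hβ₂1 (g := G k i) ih
      rw [← hv] at hstep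
      have hcoord : h (k + 1) i = β₁ * h k i + (1 - β₁) * G k i := by simp [hh]
      rw [hcoord]
      refine hstep.trans (mul_le_mul_of_nonneg_left ?_ hC.le)
      rw [hvhat]
      exact le_max_left _ _
  intro k
  have hcoord (i : Fin p) : ((θ (k + 1) - θ k) i) ^ 2 ≤
      α k ^ 2 * ((1 - β₂)⁻¹ * (1 - β₁ ^ 2 / β₂)⁻¹) := by
    have hpos : 0 < ε + vhat (k + 1) i := add_pos_of_pos_of_nonneg hε (hvhat_nonneg _ i)
    have heq : ((θ (k + 1) - θ k) i) ^ 2 =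
        α k ^ 2 * (h (k + 1) i ^ 2 / (ε + vhat (k + 1) i)) := by
      rw [PiLp.sub_apply, hθ, sub_sub_cancel_left, neg_sq, mul_pow, mul_pow, inv_pow,
        Real.sq_sqrt hpos.le]
      ring
    rw [heq]
    refine mul_le_mul_of_nonneg_left ?_ (sq_nonneg _)
    rw [div_le_iff₀ hpos]
    refine (hmom (k + 1) i).trans (mul_le_mul_of_nonneg_left ?_ hC.le)
    linarith
  rw [EuclideanSpace.real_norm_sq_eq]
  calc ∑ i, ((θ (k + 1) - θ k) i) ^ 2
      ≤ ∑ _i : Fin p, α k ^ 2 * ((1 - β₂)⁻¹ * (1 - β₁ ^ 2 / β₂)⁻¹) :=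
        Finset.sum_le_sum fun i _ => hcoord i
    _ = _ := by
        rw [Finset.sum_const, Finset.card_univ, Fintype.card_fin, nsmul_eq_mul]
        ring
end
end

section
/- Weighted Cauchy–Schwarz bound on the momentum coordinates. Let 0 ≤ β₁ < √β₂ < 1 and set β₃ = β₁²/β₂. Let (∇^k)_{k ≥ 0} be any sequence in ℝ^p and define h^{k+1} = β₁ h^k + (1−β₁) ∇^k with h⁰ = 0. Then for every k ≥ 0 and every coordinate i ∈ {1, …, p}: |h_i^{k+1}| ≤ (1−β₃)^{−1/2} (∑_{l=0}^k β₂^{k−l} (∇_i^l)²)^{1/2}. -/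
noncomputable section

/-- One step of the momentum recursion, with squared decay `s ^ 2` and `r ^ 2 = β₃`. -/
lemma one_sub_sq_mul_sq_momentum_le {r s : ℝ} (h₀ : 0 ≤ r * s) (h₁ : r * s ≤ 1) (x g : ℝ) :
    (1 - r ^ 2) * (r * s * x + (1 - r * s) * g) ^ 2 ≤
      s ^ 2 * ((1 - r ^ 2) * x ^ 2) + g ^ 2 := by
  have hg : 0 ≤ r * s * (2 - r * s) * g ^ 2 :=
    mul_nonneg (mul_nonneg h₀ (by linarith)) (sq_nonneg g)
  linarith [sq_nonneg (s * (1 - r ^ 2) * x - r * (1 - r * s) * g)]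

lemma sum_range_succ_pow_sub_mul {R : Type*} [CommSemiring R] (a : R) (f : ℕ → R) (n : ℕ) :
    ∑ l ∈ Finset.range (n + 1), a ^ (n - l) * f l =
      a * ∑ l ∈ Finset.range n, a ^ (n - 1 - l) * f l + f n := by
  rw [Finset.sum_range_succ, Finset.mul_sum, Nat.sub_self, pow_zero, one_mul]
  congr 1
  refine Finset.sum_congr rfl fun l hl => ?_
  have hl : n - l = n - 1 - l + 1 := by have := Finset.mem_range.mp hl; omega
  rw [hl, pow_succ']
  ring

/-- The squared form of the momentum bound, for real sequences. -/
lemma one_sub_sq_mul_sq_momentum_le_sum {r s : ℝ} (h₀ : 0 ≤ r * s) (h₁ : r * s ≤ 1)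
    {g x : ℕ → ℝ} (hx₀ : x 0 = 0)
    (hx : ∀ k, x (k + 1) = r * s * x k + (1 - r * s) * g k) (k : ℕ) :
    (1 - r ^ 2) * x k ^ 2 ≤ ∑ l ∈ Finset.range k, (s ^ 2) ^ (k - 1 - l) * g l ^ 2 := by
  induction k with
  | zero => simp [hx₀]
  | succ k ih =>
    rw [Nat.add_sub_cancel, sum_range_succ_pow_sub_mul (s ^ 2) (fun l => g l ^ 2), hx]
    refine (one_sub_sq_mul_sq_momentum_le h₀ h₁ (x k) (g k)).trans ?_
    gcongr

/-- Weighted Cauchy–Schwarz bound on the momentum coordinates: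
`|h_i^{k+1}| ≤ (1−β₃)^{−1/2} (∑_{l=0}^k β₂^{k−l} (∇_i^l)²)^{1/2}` with `β₃ = β₁²/β₂`. -/
theorem momentum_weighted_cauchy_schwarz
    (p : ℕ) (β₁ β₂ : ℝ)
    (hβ₁ : 0 ≤ β₁) (hβ₁₂ : β₁ < Real.sqrt β₂) (hβ₂ : Real.sqrt β₂ < 1)
    (β₃ : ℝ) (hβ₃ : β₃ = β₁ ^ 2 / β₂)
    (G : ℕ → EuclideanSpace ℝ (Fin p))
    (h : ℕ → EuclideanSpace ℝ (Fin p))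
    (hh0 : h 0 = 0)
    (hh : ∀ k, h (k + 1) = β₁ • h k + (1 - β₁) • G k) :
    ∀ (k : ℕ) (i : Fin p),
      |h (k + 1) i| ≤
        (Real.sqrt (1 - β₃))⁻¹ *
          Real.sqrt (∑ l ∈ Finset.range (k + 1), β₂ ^ (k - l) * (G l i) ^ 2) := by
  intro k i
  have hs : 0 < √β₂ := hβ₁.trans_lt hβ₁₂
  have hs_sq : √β₂ ^ 2 = β₂ := Real.sq_sqrt (Real.sqrt_pos.mp hs).le
  have hrs : β₁ / √β₂ * √β₂ = β₁ := div_mul_cancel₀ _ hs.ne'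
  have hr_sq : (β₁ / √β₂) ^ 2 = β₃ := by rw [div_pow, hs_sq, hβ₃]
  have hβ₃_lt : 0 < 1 - β₃ := by
    have hr : (β₁ / √β₂) ^ 2 < 1 :=
      pow_lt_one₀ (by positivity) ((div_lt_one hs).mpr hβ₁₂) two_ne_zero
    linarith
  have key := one_sub_sq_mul_sq_momentum_le_sum (r := β₁ / √β₂) (s := √β₂)
    (g := fun l => G l i) (x := fun l => h l i) (by rwa [hrs]) (by rw [hrs]; linarith)
    (by simp [hh0]) (fun l => by simp [hrs, hh]) (k + 1)
  rw [hr_sq, hs_sq, Nat.add_sub_cancel] at key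
  rw [inv_mul_eq_div, le_div_iff₀ (Real.sqrt_pos.mpr hβ₃_lt)]
  refine Real.le_sqrt_of_sq_le ?_
  rwa [mul_pow, sq_abs, Real.sq_sqrt hβ₃_lt.le, mul_comm]
end
end

section
/- Lower bound on the maximal second-moment estimate and the resulting ratio bound. Let 0 ≤ β₁ < √β₂ < 1 and set β₃ = β₁²/β₂. Let (∇^k)_{k ≥ 0} be any sequence in ℝ^p. Define h^{k+1} = β₁ h^k + (1−β₁) ∇^k with h⁰ = 0, and entrywise v_i^{k+1} = β₂ v̂_i^k + (1−β₂)(∇_i^k)² and v̂_i^{k+1} = max{v_i^{k+1}, v̂_i^k} with v̂_i^0 ≥ 0 for every i. Then for every k ≥ 0 and every coordinate i: (a) v̂_i^{k+1} ≥ (1−β₂) ∑_{l=0}^k β₂^{k−l} (∇_i^l)², and (b) |h_i^{k+1}|² ≤ (1−β₂)^{−1} (1−β₃)^{−1} v̂_i^{k+1}. -/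
noncomputable section

/-- A sequence dominating an exponential moving average dominates its unrolled sum. -/
theorem weighted_sum_le_of_recurrence {b c : ℝ} (hb : 0 ≤ b) {u w : ℕ → ℝ} (hw0 : 0 ≤ w 0)
    (hw : ∀ k, b * w k + c * u k ≤ w (k + 1)) (k : ℕ) :
    c * ∑ l ∈ Finset.range k, b ^ (k - 1 - l) * u l ≤ w k := by
  induction k with
  | zero => simpa using hw0
  | succ k ih =>
    refine le_trans (le_trans (le_of_eq ?_) (add_le_add_left
      (mul_le_mul_of_nonneg_left ih hb) (c * u k))) (hw k)
    have hshift : ∑ l ∈ Finset.range k, b ^ (k - l) * u l =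
        b * ∑ l ∈ Finset.range k, b ^ (k - 1 - l) * u l := by
      rw [Finset.mul_sum]
      refine Finset.sum_congr rfl fun l hl => ?_
      have hlk := Finset.mem_range.mp hl
      rw [show k - l = k - 1 - l + 1 by omega, pow_succ]
      ring
    rw [Nat.add_sub_cancel, Finset.sum_range_succ, hshift, Nat.sub_self, pow_zero]
    ring

/-- A weighted Young inequality for a linear combination of two reals. -/
theorem sq_add_le_of_sq_lt {a b : ℝ} (hab : a ^ 2 < b) (x y : ℝ) :
    (a * x + y) ^ 2 ≤ b * x ^ 2 + (1 - a ^ 2 / b)⁻¹ * y ^ 2 := by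
  have hb : 0 < b := (sq_nonneg a).trans_lt hab
  have hd : 0 < b - a ^ 2 := sub_pos.mpr hab
  have hinv : (1 - a ^ 2 / b)⁻¹ = b / (b - a ^ 2) := by
    rw [one_sub_div hb.ne', inv_div]
  have hdiff : b * x ^ 2 + b / (b - a ^ 2) * y ^ 2 - (a * x + y) ^ 2 =
      ((b - a ^ 2) * x - a * y) ^ 2 / (b - a ^ 2) := by
    field_simp
    ring
  rw [hinv, ← sub_nonneg, hdiff]
  positivity

/-- The square of a momentum sequence is bounded by any sequence dominating the moving average
of the squared inputs, up to a constant. -/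
theorem momentum_sq_le {a b : ℝ} (ha0 : 0 ≤ a) (ha1 : a ≤ 1) (hab : a ^ 2 < b) (hb1 : b < 1)
    {g m w : ℕ → ℝ} (hm0 : m 0 = 0) (hm : ∀ k, m (k + 1) = a * m k + (1 - a) * g k)
    (hw0 : 0 ≤ w 0) (hw : ∀ k, b * w k + (1 - b) * g k ^ 2 ≤ w (k + 1)) (k : ℕ) :
    m k ^ 2 ≤ (1 - b)⁻¹ * (1 - a ^ 2 / b)⁻¹ * w k := by
  have hb : 0 < b := (sq_nonneg a).trans_lt hab
  have hr : 0 < (1 - a ^ 2 / b)⁻¹ := inv_pos.mpr (sub_pos.mpr ((div_lt_one hb).mpr hab))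
  have hb' : 0 < 1 - b := sub_pos.mpr hb1
  induction k with
  | zero =>
    rw [hm0, zero_pow two_ne_zero]
    positivity
  | succ k ih =>
    set r := (1 - a ^ 2 / b)⁻¹
    have hg : ((1 - a) * g k) ^ 2 ≤ g k ^ 2 := by
      rw [mul_pow]
      exact mul_le_of_le_one_left (sq_nonneg _) (pow_le_one₀ (by linarith) (by linarith))
    calc m (k + 1) ^ 2 = (a * m k + (1 - a) * g k) ^ 2 := by rw [hm]
      _ ≤ b * m k ^ 2 + r * ((1 - a) * g k) ^ 2 := sq_add_le_of_sq_lt hab _ _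
      _ ≤ b * ((1 - b)⁻¹ * r * w k) + r * g k ^ 2 := by gcongr
      _ = (1 - b)⁻¹ * r * (b * w k + (1 - b) * g k ^ 2) := by field_simp
      _ ≤ (1 - b)⁻¹ * r * w (k + 1) := by gcongr; exact hw k

/-- Lower bound on the maximal second-moment estimate and the resulting ratio bound:
(a) `v̂_i^{k+1} ≥ (1−β₂) ∑_{l=0}^k β₂^{k−l} (∇_i^l)²` and
(b) `|h_i^{k+1}|² ≤ (1−β₂)⁻¹ (1−β₃)⁻¹ v̂_i^{k+1}`, with `β₃ = β₁²/β₂`. -/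
theorem second_moment_lower_and_ratio_bound
    (p : ℕ) (β₁ β₂ : ℝ)
    (hβ₁ : 0 ≤ β₁) (hβ₁₂ : β₁ < Real.sqrt β₂) (hβ₂ : Real.sqrt β₂ < 1)
    (β₃ : ℝ) (hβ₃ : β₃ = β₁ ^ 2 / β₂)
    (G : ℕ → EuclideanSpace ℝ (Fin p))
    (h v : ℕ → EuclideanSpace ℝ (Fin p)) (vhat : ℕ → Fin p → ℝ)
    (hh0 : h 0 = 0)
    (hh : ∀ k, h (k + 1) = β₁ • h k + (1 - β₁) • G k)
    (hv : ∀ k i, v (k + 1) i = β₂ * vhat k i + (1 - β₂) * (G k i) ^ 2)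
    (hvhat : ∀ k i, vhat (k + 1) i = max (v (k + 1) i) (vhat k i))
    (hvhat0 : ∀ i, 0 ≤ vhat 0 i) :
    ∀ (k : ℕ) (i : Fin p),
      (1 - β₂) * ∑ l ∈ Finset.range (k + 1), β₂ ^ (k - l) * (G l i) ^ 2 ≤ vhat (k + 1) i ∧
      (h (k + 1) i) ^ 2 ≤ (1 - β₂)⁻¹ * (1 - β₃)⁻¹ * vhat (k + 1) i := by
  intro k i
  have hβ₂pos : 0 < β₂ := Real.sqrt_pos.mp (hβ₁.trans_lt hβ₁₂)
  have hβ₂1 : β₂ < 1 := by simpa using (Real.sqrt_lt' one_pos).mp hβ₂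
  have hw : ∀ k, β₂ * vhat k i + (1 - β₂) * G k i ^ 2 ≤ vhat (k + 1) i := fun k => by
    rw [hvhat, ← hv]
    exact le_max_left _ _
  subst hβ₃
  refine ⟨?_, ?_⟩
  · simpa using weighted_sum_le_of_recurrence (u := fun l => G l i ^ 2)
      (w := fun l => vhat l i) hβ₂pos.le (hvhat0 i) hw (k + 1)
  · exact momentum_sq_le (g := fun l => G l i) (m := fun l => h l i) (w := fun l => vhat l i)
      hβ₁ (hβ₁₂.trans hβ₂).le ((Real.lt_sqrt hβ₁).mp hβ₁₂) hβ₂1 (by simp [hh0])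
      (fun l => by simp [hh]) (hvhat0 i) hw (k + 1)
end
end

section
/- Variance-reduced bound for the SVRG-type correction used by CADA1 (inequality (22) of the paper, finite-sample form). Assume the convex finite-sum setup. Then for every m ∈ {1, …, M} and all θ, θ̃ ∈ ℝ^p: (1/n) ∑_{j=1}^n ‖∇ℓ_{m,j}(θ) − ∇ℓ_{m,j}(θ̃) + ∇L_m(θ̃) − ∇L_m(θ*)‖² ≤ 4 M L̄ (L(θ) − L(θ*)) + 4 M L̄ (L(θ̃) − L(θ*)). -/
open scoped RealInnerProductSpace BigOperators

noncomputable section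

section Gradient

variable {E : Type*} [NormedAddCommGroup E] [InnerProductSpace ℝ E] [CompleteSpace E]

theorem HasGradientAt.hasDerivAt_comp_line {f : E → ℝ} {f' x v : E} {t : ℝ}
    (hf : HasGradientAt f f' (x + t • v)) :
    HasDerivAt (fun s : ℝ => f (x + s • v)) ⟪f', v⟫ t := by
  have hline : HasDerivAt (fun s : ℝ => x + s • v) v t := by
    simpa using ((hasDerivAt_id t).smul_const v).const_add x
  simpa [Function.comp_def] using hf.hasFDerivAt.comp_hasDerivAt t hline

theorem ConvexOn.add_inner_gradient_le {f : E → ℝ} {f' x : E} (hf : ConvexOn ℝ Set.univ f)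
    (hf' : HasGradientAt f f' x) (y : E) : f x + ⟪f', y - x⟫ ≤ f y := by
  have hconv : ConvexOn ℝ Set.univ (fun s : ℝ => f (x + s • (y - x))) := by
    simpa [Function.comp_def, AffineMap.lineMap_apply, add_comm] using
      hf.comp_affineMap (AffineMap.lineMap (k := ℝ) x y)
  have hderiv : HasDerivAt (fun s : ℝ => f (x + s • (y - x))) ⟪f', y - x⟫ 0 :=
    HasGradientAt.hasDerivAt_comp_line (by simpa using hf')
  have h := hconv.le_slope_of_hasDerivAt (Set.mem_univ 0) (Set.mem_univ 1) one_pos hderiv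
  simp only [slope_def_field, zero_smul, add_zero, one_smul, add_sub_cancel, sub_zero,
    div_one] at h
  linarith

theorem LipschitzWith.le_add_inner_gradient_add_sq {f : E → ℝ} {g : E → E} {K : NNReal}
    (hf : ∀ x, HasGradientAt f (g x) x) (hg : LipschitzWith K g) (x y : E) :
    f y ≤ f x + ⟪g x, y - x⟫ + K / 2 * ‖y - x‖ ^ 2 := by
  set v := y - x with hv
  have hderiv (t : ℝ) : HasDerivAt
      (fun s : ℝ => f (x + s • v) - s * ⟪g x, v⟫ - s ^ 2 * (K / 2 * ‖v‖ ^ 2))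
      (⟪g (x + t • v), v⟫ - ⟪g x, v⟫ - 2 * t * (K / 2 * ‖v‖ ^ 2)) t := by
    simpa using ((hf _).hasDerivAt_comp_line.fun_sub ((hasDerivAt_id t).mul_const ⟪g x, v⟫)).fun_sub
      ((hasDerivAt_pow 2 t).mul_const ((K : ℝ) / 2 * ‖v‖ ^ 2))
  have hanti := antitoneOn_of_deriv_nonpos (convex_Icc (0 : ℝ) 1)
    (fun t _ => (hderiv t).continuousAt.continuousWithinAt)
    (fun t _ => (hderiv t).differentiableAt.differentiableWithinAt) (fun t ht => by
      rw [interior_Icc] at ht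
      rw [(hderiv t).deriv, ← inner_sub_left]
      have hlip : ‖g (x + t • v) - g x‖ ≤ K * (t * ‖v‖) := by
        simpa [norm_smul, abs_of_pos ht.1] using hg.norm_sub_le (x + t • v) x
      have hinner := (real_inner_le_norm (g (x + t • v) - g x) v).trans
        (mul_le_mul_of_nonneg_right hlip (norm_nonneg v))
      linarith)
  have h := hanti (Set.left_mem_Icc.2 zero_le_one) (Set.right_mem_Icc.2 zero_le_one) zero_le_one
  simp only [one_smul, zero_smul, add_zero, hv, add_sub_cancel] at h
  rw [← hv] at h
  linarith

theorem ConvexOn.norm_gradient_sub_sq_le {f : E → ℝ} {g : E → E} {K : NNReal}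
    (hconv : ConvexOn ℝ Set.univ f) (hf : ∀ x, HasGradientAt f (g x) x)
    (hg : LipschitzWith K g) (hK : 0 < K) (x y : E) :
    ‖g y - g x‖ ^ 2 ≤ 2 * K * (f y - f x - ⟪g x, y - x⟫) := by
  have hK' : (0 : ℝ) < K := hK
  set d := g y - g x with hd
  have hdescent := hg.le_add_inner_gradient_add_sq hf y (y - (K : ℝ)⁻¹ • d)
  have hlower := hconv.add_inner_gradient_le (hf x) (y - (K : ℝ)⁻¹ • d)
  have hdd : ⟪g y, d⟫ - ⟪g x, d⟫ = ‖d‖ ^ 2 := by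
    rw [← inner_sub_left, ← hd, real_inner_self_eq_norm_sq]
  rw [sub_right_comm, inner_sub_right _ (y - x), real_inner_smul_right] at hlower
  rw [sub_sub_cancel_left, inner_neg_right, real_inner_smul_right, norm_neg, norm_smul,
    Real.norm_of_nonneg (inv_nonneg.2 hK'.le)] at hdescent
  have hsq : (K : ℝ) / 2 * ((K : ℝ)⁻¹ * ‖d‖) ^ 2 = (K : ℝ)⁻¹ * ‖d‖ ^ 2 / 2 := by
    field_simp
  have hgap : (K : ℝ)⁻¹ * ‖d‖ ^ 2 / 2 ≤ f y - f x - ⟪g x, y - x⟫ := by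
    have := congrArg (fun r => (K : ℝ)⁻¹ * r) hdd
    simp only [mul_sub] at this
    linarith
  calc ‖d‖ ^ 2 = 2 * K * ((K : ℝ)⁻¹ * ‖d‖ ^ 2 / 2) := by field_simp
    _ ≤ _ := by gcongr

theorem HasGradientAt.const_mul_sum {ι : Type*} [Fintype ι] {f : ι → E → ℝ} {f' : ι → E} {x : E}
    (c : ℝ) (hf : ∀ i, HasGradientAt (f i) (f' i) x) :
    HasGradientAt (fun y => c * ∑ i, f i y) (c • ∑ i, f' i) x := by
  rw [hasGradientAt_iff_hasFDerivAt]
  simpa using (HasFDerivAt.fun_sum fun i (_ : i ∈ Finset.univ) => (hf i).hasFDerivAt).const_mul c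

end Gradient

theorem sum_norm_sub_sq_le_of_sum_eq {E ι : Type*} [NormedAddCommGroup E] [InnerProductSpace ℝ E]
    [Fintype ι] {b : ι → E} {c : E} (hc : ∑ i, b i = (Fintype.card ι : ℝ) • c) :
    ∑ i, ‖b i - c‖ ^ 2 ≤ ∑ i, ‖b i‖ ^ 2 := by
  have h : ∑ i, ‖b i - c‖ ^ 2 = ∑ i, ‖b i‖ ^ 2 - Fintype.card ι * ‖c‖ ^ 2 := by
    simp only [norm_sub_sq_real, Finset.sum_add_distrib, Finset.sum_sub_distrib,
      ← Finset.mul_sum, ← sum_inner, hc, real_inner_smul_left, real_inner_self_eq_norm_sq,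
      Finset.sum_const, Finset.card_univ, nsmul_eq_mul]
    ring
  rw [h]
  exact sub_le_self _ (by positivity)

theorem norm_sub_sq_le_two_mul {E : Type*} [SeminormedAddCommGroup E] (a b : E) :
    ‖a - b‖ ^ 2 ≤ 2 * ‖a‖ ^ 2 + 2 * ‖b‖ ^ 2 := by
  nlinarith [norm_sub_le a b, norm_nonneg (a - b), sq_nonneg (‖a‖ - ‖b‖)]

/-- Variance-reduced bound for the SVRG-type correction used by CADA1
(inequality (22) of the paper, finite-sample form). -/
theorem svrg_correction_variance_bound
    (p n M : ℕ) (hp : 1 ≤ p) (hn : 1 ≤ n) (hM : 1 ≤ M) (Lbar : ℝ) (hLbar : 0 < Lbar)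
    (ℓ : Fin M → Fin n → EuclideanSpace ℝ (Fin p) → ℝ)
    (gℓ : Fin M → Fin n → EuclideanSpace ℝ (Fin p) → EuclideanSpace ℝ (Fin p))
    (hconv : ∀ m j, ConvexOn ℝ Set.univ (ℓ m j))
    (hgrad : ∀ m j x, HasGradientAt (ℓ m j) (gℓ m j x) x)
    (hlip : ∀ m j, LipschitzWith Lbar.toNNReal (gℓ m j))
    (Lm : Fin M → EuclideanSpace ℝ (Fin p) → ℝ)
    (hLm : ∀ m x, Lm m x = (n : ℝ)⁻¹ * ∑ j, ℓ m j x)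
    (gLm : Fin M → EuclideanSpace ℝ (Fin p) → EuclideanSpace ℝ (Fin p))
    (hgLm : ∀ m x, HasGradientAt (Lm m) (gLm m x) x)
    (L : EuclideanSpace ℝ (Fin p) → ℝ)
    (hL : ∀ x, L x = (M : ℝ)⁻¹ * ∑ m, Lm m x)
    (θstar : EuclideanSpace ℝ (Fin p))
    (hmin : ∀ x, L θstar ≤ L x)
    :
    ∀ (m : Fin M) (θ θtil : EuclideanSpace ℝ (Fin p)),
      (n : ℝ)⁻¹ * ∑ j, ‖gℓ m j θ - gℓ m j θtil + gLm m θtil - gLm m θstar‖ ^ 2 ≤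
        4 * M * Lbar * (L θ - L θstar) + 4 * M * Lbar * (L θtil - L θstar) := by
  intro m θ θtil
  have hn0 : (n : ℝ) ≠ 0 := by positivity
  have hM0 : (M : ℝ) ≠ 0 := by positivity
  have hK : ((Lbar.toNNReal : NNReal) : ℝ) = Lbar := Real.coe_toNNReal _ hLbar.le
  have hgLm_eq (k x) : gLm k x = (n : ℝ)⁻¹ • ∑ j, gℓ k j x :=
    (funext (hLm k) ▸ hgLm k x).unique (HasGradientAt.const_mul_sum _ fun j => hgrad k j x)
  have hgL_zero : (M : ℝ)⁻¹ • ∑ k, gLm k θstar = 0 := by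
    have hgL : HasGradientAt L ((M : ℝ)⁻¹ • ∑ k, gLm k θstar) θstar :=
      funext hL ▸ HasGradientAt.const_mul_sum _ fun k => hgLm k θstar
    have hloc : IsLocalMin L θstar := Filter.Eventually.of_forall hmin
    exact (map_eq_zero_iff _ (InnerProductSpace.toDual ℝ _).injective).1
      (hloc.hasFDerivAt_eq_zero hgL.hasFDerivAt)
  -- The Bregman divergences at the minimizer of the local and of the sample losses.
  let B (k : Fin M) (x : EuclideanSpace ℝ (Fin p)) : ℝ :=
    Lm k x - Lm k θstar - ⟪gLm k θstar, x - θstar⟫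
  let D (k : Fin M) (j : Fin n) (x : EuclideanSpace ℝ (Fin p)) : ℝ :=
    ℓ k j x - ℓ k j θstar - ⟪gℓ k j θstar, x - θstar⟫
  have hB (k x) : B k x = (n : ℝ)⁻¹ * ∑ j, D k j x := by
    simp only [B, D, hLm, hgLm_eq, real_inner_smul_left, sum_inner, Finset.sum_sub_distrib]
    ring
  have hD_nonneg (k j x) : 0 ≤ D k j x := by
    have := (hconv k j).add_inner_gradient_le (hgrad k j θstar) x
    simp only [D]
    linarith
  have hB_nonneg (k x) : 0 ≤ B k x := by
    rw [hB]
    exact mul_nonneg (by positivity) (Finset.sum_nonneg fun j _ => hD_nonneg k j x)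
  have hB_le (x) : B m x ≤ M * (L x - L θstar) := by
    have hsum : ∑ k, B k x = M * (L x - L θstar) := by
      have hinner : ∑ k, ⟪gLm k θstar, x - θstar⟫ = 0 := by
        rw [← sum_inner, (smul_eq_zero.1 hgL_zero).resolve_left (inv_ne_zero hM0),
          inner_zero_left]
      simp only [B, Finset.sum_sub_distrib, hinner, hL]
      field_simp
      ring
    exact hsum ▸ Finset.single_le_sum (fun k _ => hB_nonneg k x) (Finset.mem_univ m)
  have hsq (x) : (n : ℝ)⁻¹ * ∑ j, ‖gℓ m j x - gℓ m j θstar‖ ^ 2 ≤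
      2 * Lbar * (M * (L x - L θstar)) := by
    calc (n : ℝ)⁻¹ * ∑ j, ‖gℓ m j x - gℓ m j θstar‖ ^ 2
        ≤ (n : ℝ)⁻¹ * ∑ j, 2 * Lbar * D m j x := by
          gcongr with j
          simpa only [hK] using (hconv m j).norm_gradient_sub_sq_le (hgrad m j) (hlip m j)
            (Real.toNNReal_pos.2 hLbar) θstar x
      _ = 2 * Lbar * B m x := by rw [hB, ← Finset.mul_sum]; ring
      _ ≤ _ := by gcongr; exact hB_le x
  have hvar : ∑ j, ‖gℓ m j θtil - gℓ m j θstar - (gLm m θtil - gLm m θstar)‖ ^ 2 ≤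
      ∑ j, ‖gℓ m j θtil - gℓ m j θstar‖ ^ 2 := by
    apply sum_norm_sub_sq_le_of_sum_eq
    rw [Fintype.card_fin, hgLm_eq, hgLm_eq, ← smul_sub, smul_inv_smul₀ hn0,
      Finset.sum_sub_distrib]
  calc (n : ℝ)⁻¹ * ∑ j, ‖gℓ m j θ - gℓ m j θtil + gLm m θtil - gLm m θstar‖ ^ 2
      ≤ (n : ℝ)⁻¹ * ∑ j, (2 * ‖gℓ m j θ - gℓ m j θstar‖ ^ 2 +
          2 * ‖gℓ m j θtil - gℓ m j θstar - (gLm m θtil - gLm m θstar)‖ ^ 2) := by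
        gcongr with j
        refine le_of_eq_of_le ?_ (norm_sub_sq_le_two_mul _ _)
        congr 2
        abel
    _ ≤ (n : ℝ)⁻¹ * (2 * ∑ j, ‖gℓ m j θ - gℓ m j θstar‖ ^ 2 +
          2 * ∑ j, ‖gℓ m j θtil - gℓ m j θstar‖ ^ 2) := by
        rw [Finset.sum_add_distrib, ← Finset.mul_sum, ← Finset.mul_sum]
        gcongr
    _ ≤ _ := by linarith [hsq θ, hsq θtil]
end
end
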